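/- Let (W,S) be a Coxeter system of rank 3 with S = {r,s,t}, in which rt = tr (the product rt has order 2) and the orders m_{sr} of sr and m_{st} of st both satisfy m_{sr} ≥ 4 and m_{st} ≥ 4 (possibly infinite). Then there is no element w of W admitting elements w₁, w₂ ∈ W with w = w₁·r, ℓ(w) = ℓ(w₁) + 1, and w = w₂·t·s, ℓ(w) = ℓ(w₂) + 2. -/

import Mathlib

open LaurentPolynomial

namespace CoxeterSystem

variable {B W : Type*} [Group W] {M : CoxeterMatrix B} (cs : CoxeterSystem M W)

open Classical in
/-- The involution of `W × ℤ/2` attached to a simple reflection: it conjugates the first component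
and flips the second exactly when the first is the reflection itself. -/
noncomputable def signedConj (i : B) : Function.End (W × ZMod 2) :=
  fun x ↦ (cs.simple i * x.1 * cs.simple i, x.2 + if x.1 = cs.simple i then 1 else 0)

theorem simple_mul_zpow (i j : B) (l : ℤ) :
    cs.simple j * (cs.simple i * cs.simple j) ^ l =
      (cs.simple i * cs.simple j) ^ (-l) * cs.simple j := by
  have h : SemiconjBy (cs.simple j) (cs.simple i * cs.simple j)
      (cs.simple i * cs.simple j)⁻¹ := by
    simp [SemiconjBy, mul_assoc]
  have := h.zpow_right l
  rwa [inv_zpow', SemiconjBy] at this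

theorem _root_.Function.End.mul_apply {α : Type*} (f g : Function.End α) (x : α) :
    (f * g) x = f (g x) := rfl

theorem _root_.Function.End.one_apply {α : Type*} (x : α) : (1 : Function.End α) x = x := rfl

open Classical in
theorem signedConj_mul_pow_apply (i j : B) (k : ℕ) (t : W) (e : ZMod 2) :
    ((cs.signedConj i * cs.signedConj j) ^ k) (t, e) =
      ((cs.simple i * cs.simple j) ^ k * t * ((cs.simple i * cs.simple j) ^ k)⁻¹,
        e + ∑ l ∈ Finset.range (2 * k),
          if t = cs.simple j * (cs.simple i * cs.simple j) ^ l then 1 else 0) := by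
  induction k with
  | zero => simp [Function.End.one_apply]
  | succ k ih =>
    have hk := cs.simple_mul_zpow i j k
    rw [zpow_neg, zpow_natCast] at hk
    rw [pow_succ', Function.End.mul_apply, ih, Function.End.mul_apply, mul_add,
      Finset.sum_range_succ, Finset.sum_range_succ, pow_succ' _ k]
    set p := cs.simple i * cs.simple j with hp
    have hpj : p * cs.simple j = cs.simple i := by simp [hp]
    have h1 : p ^ k * t * (p ^ k)⁻¹ = cs.simple j ↔ t = cs.simple j * p ^ (2 * k) := by
      rw [mul_inv_eq_iff_eq_mul, ← eq_inv_mul_iff_mul_eq, ← mul_assoc, ← hk, mul_assoc,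
        ← pow_add, two_mul]
    have h2 : cs.simple j * (p ^ k * t * (p ^ k)⁻¹) * cs.simple j = cs.simple i ↔
        t = cs.simple j * p ^ (2 * k + 1) := by
      have h3 : cs.simple j * (p ^ k * t * (p ^ k)⁻¹) * cs.simple j = cs.simple i ↔
          p ^ k * t * (p ^ k)⁻¹ = cs.simple j * p := by
        rw [← hpj, mul_left_inj, ← eq_inv_mul_iff_mul_eq, inv_simple]
      rw [h3, mul_inv_eq_iff_eq_mul, ← eq_inv_mul_iff_mul_eq, ← mul_assoc, ← mul_assoc, ← hk,
        mul_assoc, mul_assoc, ← pow_succ', ← pow_add]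
      ring_nf
    simp only [signedConj, h1, h2, Prod.mk.injEq]
    constructor
    · simp [hp, mul_assoc]
    · ring

theorem isLiftable_signedConj : M.IsLiftable cs.signedConj := by
  classical
  intro i j
  funext ⟨t, e⟩
  rw [signedConj_mul_pow_apply, two_mul, Finset.sum_range_add]
  simp [pow_add, CharTwo.add_self_eq_zero, Function.End.one_apply]

/-- The action of `W` on `W × ℤ/2` extending `signedConj`. -/
noncomputable def signedConjHom : W →* Function.End (W × ZMod 2) :=
  cs.lift ⟨cs.signedConj, cs.isLiftable_signedConj⟩

/-- The parity of the number of occurrences of `t` in the right inversion sequence of any word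
for `w`. -/
noncomputable def inversionParity (w t : W) : ZMod 2 := (cs.signedConjHom w (t, 0)).2

theorem signedConjHom_simple (i : B) : cs.signedConjHom (cs.simple i) = cs.signedConj i :=
  cs.lift_apply_simple cs.isLiftable_signedConj i

theorem signedConjHom_apply (w t : W) (e : ZMod 2) :
    cs.signedConjHom w (t, e) = (w * t * w⁻¹, e + cs.inversionParity w t) := by
  induction w using cs.simple_induction_left generalizing e with
  | one => simp [inversionParity, Function.End.one_apply]
  | mul_simple_left w i ih =>
    rw [inversionParity, map_mul, Function.End.mul_apply, Function.End.mul_apply,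
      ih, ih, signedConjHom_simple]
    simp [signedConj, mul_assoc, add_assoc]

theorem inversionParity_mul (v w t : W) :
    cs.inversionParity (v * w) t =
      cs.inversionParity w t + cs.inversionParity v (w * t * w⁻¹) := by
  rw [inversionParity, map_mul, Function.End.mul_apply, signedConjHom_apply,
    signedConjHom_apply, zero_add]

@[simp]
theorem inversionParity_one (t : W) : cs.inversionParity 1 t = 0 := by
  rw [inversionParity, map_one]; rfl

open Classical in
theorem inversionParity_simple (i : B) (t : W) :
    cs.inversionParity (cs.simple i) t = if t = cs.simple i then 1 else 0 := by
  simp [inversionParity, signedConjHom_simple, signedConj]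

open Classical in
theorem inversionParity_mul_simple (w t : W) (i : B) :
    cs.inversionParity (w * cs.simple i) t =
      (if t = cs.simple i then 1 else 0) +
        cs.inversionParity w (cs.simple i * t * cs.simple i) := by
  rw [inversionParity_mul, inversionParity_simple, inv_simple]

theorem mem_rightInvSeq_of_inversionParity_ne_zero {ω : List B} {t : W}
    (h : cs.inversionParity (cs.wordProd ω) t ≠ 0) : t ∈ cs.rightInvSeq ω := by
  classical
  induction ω with
  | nil => simp at h
  | cons i ω ih =>
    rw [wordProd_cons, inversionParity_mul, inversionParity_simple] at h
    rw [rightInvSeq, List.mem_cons]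
    by_cases ht : cs.wordProd ω * t * (cs.wordProd ω)⁻¹ = cs.simple i
    · left
      rw [← ht]
      group
    · right
      exact ih (by simpa [ht] using h)

theorem length_mul_lt_of_inversionParity_ne_zero {w t : W} (h : cs.inversionParity w t ≠ 0) :
    cs.length (w * t) < cs.length w := by
  obtain ⟨ω, hω, rfl⟩ := cs.exists_isReduced w
  exact (cs.isRightInversion_of_mem_rightInvSeq hω
    (cs.mem_rightInvSeq_of_inversionParity_ne_zero h)).2

theorem isRightDescent_iff_inversionParity {w : W} {i : B} :
    cs.IsRightDescent w i ↔ cs.inversionParity w (cs.simple i) = 1 := by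
  classical
  constructor
  · intro h
    by_contra hn
    have h0 : cs.inversionParity w (cs.simple i) = 0 := by
      generalize cs.inversionParity w (cs.simple i) = x at hn
      revert x; decide
    have h1 : cs.inversionParity (w * cs.simple i) (cs.simple i) ≠ 0 := by
      simp [inversionParity_mul_simple, h0]
    have := cs.length_mul_lt_of_inversionParity_ne_zero h1
    rw [simple_mul_simple_cancel_right] at this
    exact lt_asymm this h
  · intro h
    exact cs.length_mul_lt_of_inversionParity_ne_zero (by simp [h])

/-- The reflections `sᵢ (sⱼ sᵢ)ˡ` of the dihedral subgroup generated by `sᵢ` and `sⱼ`. -/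
def dihedralReflection (i j : B) (l : ℤ) : W := cs.simple i * (cs.simple j * cs.simple i) ^ l

open Classical in
/-- The inversion parity of `w` along the dihedral reflections changes only at the index `0` and at
one further index `c`, up to the order of `sⱼ sᵢ`. -/
def HasDihedralJump (i j : B) (w : W) : Prop :=
  ∃ c : ℤ, ∀ l : ℤ,
    cs.inversionParity w (cs.dihedralReflection i j l) +
      cs.inversionParity w (cs.dihedralReflection i j (l - 1)) =
    (if (cs.simple j * cs.simple i) ^ l = 1 then 1 else 0) +
      if (cs.simple j * cs.simple i) ^ (l - c) = 1 then 1 else 0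

theorem dihedralReflection_eq_left_iff (i j : B) (l : ℤ) :
    cs.dihedralReflection i j l = cs.simple i ↔ (cs.simple j * cs.simple i) ^ l = 1 := by
  simp [dihedralReflection]

theorem dihedralReflection_neg_one (i j : B) :
    cs.dihedralReflection i j (-1) = cs.simple j := by
  simp [dihedralReflection]

theorem dihedralReflection_eq_right_iff (i j : B) (l : ℤ) :
    cs.dihedralReflection i j l = cs.simple j ↔ (cs.simple j * cs.simple i) ^ (l + 1) = 1 := by
  have h : cs.simple j = cs.simple i * (cs.simple j * cs.simple i)⁻¹ := by simp
  conv_lhs => rw [h]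
  rw [dihedralReflection, mul_right_inj, ← mul_inv_eq_one, inv_inv, ← zpow_add_one]

theorem conj_left_dihedralReflection (i j : B) (l : ℤ) :
    cs.simple i * cs.dihedralReflection i j l * cs.simple i =
      cs.dihedralReflection i j (-l) := by
  rw [dihedralReflection, dihedralReflection, cs.simple_mul_zpow j i (-l), neg_neg,
    simple_mul_simple_cancel_left]

theorem conj_right_dihedralReflection (i j : B) (l : ℤ) :
    cs.simple j * cs.dihedralReflection i j l * cs.simple j =
      cs.dihedralReflection i j (-l - 2) := by
  have h : cs.simple j = cs.simple i * (cs.simple j * cs.simple i)⁻¹ := by simp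
  have h' : cs.simple j * cs.dihedralReflection i j l =
      (cs.simple j * cs.simple i) ^ (l + 1) := by
    rw [dihedralReflection, ← mul_assoc, add_comm, zpow_one_add]
  rw [h']
  nth_rw 2 [h]
  rw [dihedralReflection, ← mul_assoc, ← neg_neg (l + 1), ← cs.simple_mul_zpow j i, mul_assoc,
    ← zpow_sub_one]
  ring_nf

variable {cs}

theorem HasDihedralJump.mul_left {i j : B} {w : W} (h : cs.HasDihedralJump i j w) :
    cs.HasDihedralJump i j (w * cs.simple i) := by
  classical
  obtain ⟨c, hc⟩ := h
  refine ⟨1 - c, fun l ↦ ?_⟩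
  have h1 := hc (1 - l)
  have e1 : (cs.simple j * cs.simple i) ^ (1 - l) = 1 ↔
      (cs.simple j * cs.simple i) ^ (l - 1) = 1 := by
    rw [← neg_sub, zpow_neg, inv_eq_one]
  have e2 : (cs.simple j * cs.simple i) ^ (1 - l - c) = 1 ↔
      (cs.simple j * cs.simple i) ^ (l - (1 - c)) = 1 := by
    rw [show 1 - l - c = -(l - (1 - c)) by ring, zpow_neg, inv_eq_one]
  simp only [e1, e2, show 1 - l - 1 = -l by ring] at h1
  simp only [inversionParity_mul_simple, conj_left_dihedralReflection,
    dihedralReflection_eq_left_iff, neg_sub]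
  have h2 : (2 : ZMod 2) = 0 := rfl
  linear_combination h1 + (if (cs.simple j * cs.simple i) ^ (l - 1) = 1 then 1 else 0) * h2

theorem HasDihedralJump.mul_right {i j : B} {w : W} (h : cs.HasDihedralJump i j w) :
    cs.HasDihedralJump i j (w * cs.simple j) := by
  classical
  obtain ⟨c, hc⟩ := h
  refine ⟨-1 - c, fun l ↦ ?_⟩
  have h1 := hc (-l - 1)
  have e1 : (cs.simple j * cs.simple i) ^ (-l - 1) = 1 ↔
      (cs.simple j * cs.simple i) ^ (l + 1) = 1 := by
    rw [show -l - 1 = -(l + 1) by ring, zpow_neg, inv_eq_one]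
  have e2 : (cs.simple j * cs.simple i) ^ (-l - 1 - c) = 1 ↔
      (cs.simple j * cs.simple i) ^ (l - (-1 - c)) = 1 := by
    rw [show -l - 1 - c = -(l - (-1 - c)) by ring, zpow_neg, inv_eq_one]
  simp only [e1, e2, show -l - 1 - 1 = -l - 2 by ring] at h1
  simp only [inversionParity_mul_simple, conj_right_dihedralReflection,
    dihedralReflection_eq_right_iff, sub_add_cancel, show -(l - 1) - 2 = -l - 1 by ring]
  have h2 : (2 : ZMod 2) = 0 := rfl
  linear_combination h1 + (if (cs.simple j * cs.simple i) ^ (l + 1) = 1 then 1 else 0) * h2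

theorem HasDihedralJump.mul_zpow {i j : B} {w : W} (h : cs.HasDihedralJump i j w) (l : ℤ) :
    cs.HasDihedralJump i j (w * (cs.simple j * cs.simple i) ^ l) := by
  induction l using Int.induction_on with
  | zero => simpa using h
  | succ n ih =>
    rw [zpow_add_one, ← mul_assoc, ← mul_assoc]
    exact ih.mul_right.mul_left
  | pred n ih =>
    rw [zpow_sub_one, mul_inv_rev, inv_simple, inv_simple, ← mul_assoc, ← mul_assoc]
    exact ih.mul_left.mul_right

variable (cs)

theorem hasDihedralJump (i j : B) (w : W) : cs.HasDihedralJump i j w := by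
  induction hn : cs.length w using Nat.strong_induction_on generalizing w with
  | _ n ih =>
    by_cases h : ∀ l, cs.inversionParity w (cs.dihedralReflection i j l) = 0
    · exact ⟨0, fun l ↦ by
        rw [h, h, sub_zero, CharTwo.add_self_eq_zero, CharTwo.add_self_eq_zero]⟩
    · push Not at h
      obtain ⟨l, hl⟩ := h
      have hlt := cs.length_mul_lt_of_inversionParity_ne_zero hl
      have key := ((ih _ (hn ▸ hlt) _ rfl).mul_zpow (-l)).mul_left
      rwa [dihedralReflection, mul_assoc, mul_assoc, mul_assoc, ← mul_assoc (_ ^ l), ← zpow_add,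
        add_neg_cancel, zpow_zero, one_mul, simple_mul_simple_self, mul_one] at key

variable {cs}

/-- If both simple reflections are right descents, every reflection of the dihedral subgroup they
generate is a right inversion. -/
theorem IsRightDescent.inversionParity_dihedralReflection {i j : B} {w : W}
    (hi : cs.IsRightDescent w i) (hj : cs.IsRightDescent w j) (l : ℤ) :
    cs.inversionParity w (cs.dihedralReflection i j l) = 1 := by
  obtain ⟨c, hc⟩ := cs.hasDihedralJump i j w
  rw [isRightDescent_iff_inversionParity] at hi hj
  have hc1 : (cs.simple j * cs.simple i) ^ c = 1 := by
    have h0 := hc 0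
    have hz : cs.dihedralReflection i j 0 = cs.simple i := by simp [dihedralReflection]
    rw [zero_sub, zero_sub, hz, dihedralReflection_neg_one, hi, hj, zpow_neg, inv_eq_one] at h0
    by_contra hne
    rw [if_pos (zpow_zero _), if_neg hne] at h0
    exact absurd h0 (by decide)
  have step (l : ℤ) : cs.inversionParity w (cs.dihedralReflection i j l) =
      cs.inversionParity w (cs.dihedralReflection i j (l - 1)) := by
    have := hc l
    rwa [zpow_sub, hc1, inv_one, mul_one, CharTwo.add_self_eq_zero, CharTwo.add_eq_zero] at this
  induction l using Int.induction_on with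
  | zero => simpa [dihedralReflection] using hi
  | succ n ih => rw [step, add_sub_cancel_right, ih]
  | pred n ih => rw [← step, ih]

theorem IsRightDescent.mul_simple {i j : B} {w : W}
    (hi : cs.IsRightDescent w i) (hj : cs.IsRightDescent w j)
    (h1 : cs.simple j * cs.simple i ≠ 1) :
    cs.IsRightDescent (w * cs.simple i) j := by
  have key : cs.inversionParity (w * cs.simple i) (cs.dihedralReflection i j (-1)) = 1 := by
    simp [inversionParity_mul_simple, conj_left_dihedralReflection,
      dihedralReflection_eq_left_iff, hi.inversionParity_dihedralReflection hj, h1,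
      -mul_inv_rev]
  rwa [dihedralReflection_neg_one, ← isRightDescent_iff_inversionParity] at key

theorem IsRightDescent.mul_simple_mul_simple {i j : B} {w : W}
    (hi : cs.IsRightDescent w i) (hj : cs.IsRightDescent w j)
    (h1 : cs.simple j * cs.simple i ≠ 1) (h2 : (cs.simple j * cs.simple i) ^ 2 ≠ 1) :
    cs.IsRightDescent (w * cs.simple i * cs.simple j) i := by
  have n0 : cs.dihedralReflection i j 0 ≠ cs.simple j := by
    rwa [Ne, dihedralReflection_eq_right_iff, zero_add, zpow_one]
  have n2 : cs.dihedralReflection i j (-0 - 2) ≠ cs.simple i := by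
    rw [Ne, dihedralReflection_eq_left_iff, neg_zero, zero_sub, zpow_neg, inv_eq_one]
    exact_mod_cast h2
  have key : cs.inversionParity (w * cs.simple i * cs.simple j)
      (cs.dihedralReflection i j 0) = 1 := by
    rw [inversionParity_mul_simple, if_neg n0, conj_right_dihedralReflection,
      inversionParity_mul_simple, if_neg n2, conj_left_dihedralReflection,
      hi.inversionParity_dihedralReflection hj, zero_add, zero_add]
  rwa [dihedralReflection, zpow_zero, mul_one, ← isRightDescent_iff_inversionParity] at key

theorem IsRightDescent.mul_simple_mul_simple_mul_simple {i j : B} {w : W}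
    (hi : cs.IsRightDescent w i) (hj : cs.IsRightDescent w j)
    (h1 : cs.simple j * cs.simple i ≠ 1) (h2 : (cs.simple j * cs.simple i) ^ 2 ≠ 1)
    (h3 : (cs.simple j * cs.simple i) ^ 3 ≠ 1) :
    cs.IsRightDescent (w * cs.simple i * cs.simple j * cs.simple i) j := by
  have n1 : cs.dihedralReflection i j (-1) ≠ cs.simple i := by
    rwa [Ne, dihedralReflection_eq_left_iff, zpow_neg_one, inv_eq_one]
  have n2 : cs.dihedralReflection i j (- -1) ≠ cs.simple j := by
    rw [Ne, dihedralReflection_eq_right_iff, neg_neg, one_add_one_eq_two]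
    exact_mod_cast h2
  have n3 : cs.dihedralReflection i j (- - -1 - 2) ≠ cs.simple i := by
    rw [Ne, dihedralReflection_eq_left_iff, show (- - -1 - 2 : ℤ) = -3 from rfl, zpow_neg,
      inv_eq_one]
    exact_mod_cast h3
  have key : cs.inversionParity (w * cs.simple i * cs.simple j * cs.simple i)
      (cs.dihedralReflection i j (-1)) = 1 := by
    rw [inversionParity_mul_simple, if_neg n1, conj_left_dihedralReflection,
      inversionParity_mul_simple, if_neg n2, conj_right_dihedralReflection,
      inversionParity_mul_simple, if_neg n3, conj_left_dihedralReflection,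
      hi.inversionParity_dihedralReflection hj, zero_add, zero_add, zero_add]
  rwa [dihedralReflection_neg_one, ← isRightDescent_iff_inversionParity] at key

/-- Given `sₐ s_c ≠ 1` and dihedral orders at least `4` for the pairs `(b, a)` and `(b, c)`, no
element has right descents `a` and `b` and a reduced word ending in `c b`. -/
theorem not_isRightDescent_mul_simple {a b c : B}
    (hac : cs.simple a * cs.simple c ≠ 1)
    (hba : orderOf (cs.simple b * cs.simple a) = 0 ∨ 4 ≤ orderOf (cs.simple b * cs.simple a))
    (hbc : orderOf (cs.simple b * cs.simple c) = 0 ∨ 4 ≤ orderOf (cs.simple b * cs.simple c))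
    {w : W} (ha : cs.IsRightDescent w a) (hb : cs.IsRightDescent w b) :
    ¬ cs.IsRightDescent (w * cs.simple b) c := by
  have swap (i j : B) {n : ℕ} (h : (cs.simple i * cs.simple j) ^ n ≠ 1) :
      (cs.simple j * cs.simple i) ^ n ≠ 1 := by
    rw [← inv_ne_one, ← inv_pow] at h
    simpa using h
  have pow_ne {x : W} (h : orderOf x = 0 ∨ 4 ≤ orderOf x) {n : ℕ} (hn : 0 < n) (hn4 : n < 4) :
      x ^ n ≠ 1 := by
    intro hx
    have := Nat.le_of_dvd hn (orderOf_dvd_of_pow_eq_one hx)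
    have := Nat.pos_of_dvd_of_pos (orderOf_dvd_of_pow_eq_one hx) hn
    omega
  have hca : cs.simple c * cs.simple a ≠ 1 := by
    simpa using swap a c (n := 1) (by simpa using hac)
  have ab (n : ℕ) (hn : 0 < n) (hn4 : n < 4) := swap b a (pow_ne hba hn hn4)
  have cb (n : ℕ) (hn : 0 < n) (hn4 : n < 4) := swap b c (pow_ne hbc hn hn4)
  have ab1 : cs.simple a * cs.simple b ≠ 1 := by simpa using ab 1
  have cb1 : cs.simple c * cs.simple b ≠ 1 := by simpa using cb 1
  induction hn : cs.length w using Nat.strong_induction_on generalizing w with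
  | _ n ih =>
    intro hc
    have wb_a := hb.mul_simple ha ab1
    have wba_b := hb.mul_simple_mul_simple ha ab1 (ab 2 (by simp) (by simp))
    have wbab_a := hb.mul_simple_mul_simple_mul_simple ha ab1 (ab 2 (by simp) (by simp))
      (ab 3 (by simp) (by simp))
    have wba_c := wb_a.mul_simple hc hca
    have wbab_c := wba_b.mul_simple wba_c cb1
    have wbabc_b := wba_b.mul_simple_mul_simple wba_c cb1 (cb 2 (by simp) (by simp))
    have wbabcb_c := wba_b.mul_simple_mul_simple_mul_simple wba_c cb1 (cb 2 (by simp) (by simp))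
      (cb 3 (by simp) (by simp))
    have wbabc_a := wbab_c.mul_simple wbab_a hac
    refine ih _ ?_ wbabc_a wbabc_b rfl wbabcb_c
    rw [← hn]
    exact wbab_c.trans (wba_b.trans (wb_a.trans hb))

end CoxeterSystem

/-- Lemma 4.1: if `m_{sr}, m_{st} ≥ 4`, there is no `w ∈ W` with
`w = (w₁)(r) = (w₂)(ts)`. -/
theorem no_element_r_and_ts
{W : Type*} [Group W] {M : CoxeterMatrix (Fin 3)} (cs : CoxeterSystem M W)
    (r s t : W) (hr : r = cs.simple 0) (hs : s = cs.simple 1) (ht : t = cs.simple 2)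
    (hrt : orderOf (r * t) = 2)
    (hsr : orderOf (s * r) = 0 ∨ 4 ≤ orderOf (s * r))
    (hst : orderOf (s * t) = 0 ∨ 4 ≤ orderOf (s * t)) :
    ¬ ∃ w w1 w2 : W,
        w = w1 * r ∧ cs.length w = cs.length w1 + 1 ∧
        w = w2 * t * s ∧ cs.length w = cs.length w2 + 2 := by
  subst hr hs ht
  rintro ⟨w, w1, w2, h1, hl1, h2, hl2⟩
  have hw1 : w * cs.simple 0 = w1 := by simp [h1]
  have hw2 : w * cs.simple 1 = w2 * cs.simple 2 := by simp [h2]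
  have hle := cs.length_mul_le w2 (cs.simple 2)
  have hge := cs.length_mul_le (w2 * cs.simple 2) (cs.simple 1)
  rw [← h2, cs.length_simple] at hge
  rw [cs.length_simple] at hle
  refine cs.not_isRightDescent_mul_simple (a := 0) (b := 1) (c := 2) (w := w) ?_ hsr hst ?_ ?_ ?_
  · intro h
    simp [h] at hrt
  · rw [CoxeterSystem.IsRightDescent, hw1]
    omega
  · rw [CoxeterSystem.IsRightDescent, hw2]
    omega
  · rw [CoxeterSystem.IsRightDescent, hw2, cs.simple_mul_simple_cancel_right]
    omega
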